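/- Let Ω ⊂ ℝⁿ be a bounded domain with a tree-covering {U_t}_{t∈Γ} obtained from a Whitney decomposition (U_t = (17/16)·int(Q_t)). Fix 0 < α < n, and let p(·), q(·) be exponent functions on Ω with 1 < p_- ≤ p_+ < ∞, 1 ≤ q_- ≤ q_+ < ∞, such that for some 0 < β < α one has 1/p(x) − 1/q(x) = β/n ≤ α/n for a.e. x ∈ Ω. If p(·) ∈ ∂LH_0^τ(Ω) for some τ ≥ 1, then the operator T^α_{p(·)} f(x) = Σ_{t∈Γ} |U_t|^{α/n} (‖χ_{U_t} f‖_{L^{p(·)}(Ω)}/‖χ_{U_t}‖_{L^{p(·)}(Ω)}) χ_{U_t}(x) is bounded from L^{p(·)}(Ω) to L^{q(·)}(Ω). -/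

import Mathlib

open MeasureTheory Metric Set Filter Topology

noncomputable section

abbrev Eucl (n : ℕ) : Type := EuclideanSpace ℝ (Fin n)

/-- Essential supremum of `p` over the set `A` (w.r.t. Lebesgue measure). -/
def essSupOn {n : ℕ} (p : Eucl n → ℝ) (A : Set (Eucl n)) : ℝ :=
  essSup p (volume.restrict A)

/-- Essential infimum of `p` over the set `A` (w.r.t. Lebesgue measure). -/
def essInfOn {n : ℕ} (p : Eucl n → ℝ) (A : Set (Eucl n)) : ℝ :=
  essInf p (volume.restrict A)

/-- The Luxemburg norm of `f` on `A` with variable exponent `p`. -/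
def luxNorm {n : ℕ} (A : Set (Eucl n)) (p f : Eucl n → ℝ) : ℝ :=
  sInf {l : ℝ | 0 < l ∧ (∫⁻ x in A, ENNReal.ofReal ((|f x| / l) ^ (p x))) ≤ 1}

/-- `f` belongs to the variable Lebesgue space `L^{p(·)}(A)`. -/
def MemVarLp {n : ℕ} (A : Set (Eucl n)) (p f : Eucl n → ℝ) : Prop :=
  ∃ l : ℝ, 0 < l ∧ (∫⁻ x in A, ENNReal.ofReal ((|f x| / l) ^ (p x))) ≤ 1

/-- `d(x) = dist(x, ∂Ω)`. -/
def bdist {n : ℕ} (Ω : Set (Eucl n)) (x : Eucl n) : ℝ :=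
  infDist x (frontier Ω)

/-- The ball `B_{x,τ} = B(x, τ d(x))`. -/
def ballB {n : ℕ} (Ω : Set (Eucl n)) (τ : ℝ) (x : Eucl n) : Set (Eucl n) :=
  ball x (τ * bdist Ω x)

/-- The boundary log-Hölder condition `∂LH₀^τ(Ω)` with constant `C₀`. -/
def BoundaryLH {n : ℕ} (Ω : Set (Eucl n)) (p : Eucl n → ℝ) (τ C₀ : ℝ) : Prop :=
  ∀ x ∈ Ω, τ * bdist Ω x ≤ 1 / 2 →
    essSupOn p (ballB Ω τ x ∩ Ω) - essInfOn p (ballB Ω τ x ∩ Ω)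
      ≤ C₀ / (-Real.log (τ * bdist Ω x))

/-- `Ω` is a John domain with parameter `lam`. -/
def JohnDomain {n : ℕ} (Ω : Set (Eucl n)) (lam : ℝ) : Prop :=
  ∃ x₀ ∈ Ω, ∀ y ∈ Ω, ∃ ℓ : ℝ, 0 ≤ ℓ ∧ ∃ γ : ℝ → Eucl n,
    γ 0 = y ∧ γ ℓ = x₀ ∧ (∀ t ∈ Icc (0:ℝ) ℓ, γ t ∈ Ω) ∧
    LipschitzOnWith 1 γ (Icc (0:ℝ) ℓ) ∧
    ∀ t ∈ Icc (0:ℝ) ℓ, t ≤ lam * infDist (γ t) (frontier Ω)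

/-- `g` is uniformly `ε`-continuous on `S`. -/
def UnifEpsCont {n : ℕ} (S : Set (Eucl n)) (g : Eucl n → ℝ) (ε : ℝ) : Prop :=
  ∃ δ : ℝ, 0 < δ ∧ ∀ x ∈ S, ∀ y ∈ S, dist x y < δ → |g y - g x| < ε

/-- `f` is locally Lipschitz on `S`. -/
def LocLipschitzOn {n : ℕ} (S : Set (Eucl n)) (f : Eucl n → ℝ) : Prop :=
  ∀ x ∈ S, ∃ K : NNReal, ∃ t ∈ 𝓝 x, LipschitzOnWith K f (t ∩ S)

/-- The average of `f` over `A`. -/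
def avgOn {n : ℕ} (A : Set (Eucl n)) (f : Eucl n → ℝ) : ℝ :=
  (volume A).toReal⁻¹ * ∫ x in A, f x

/-- The pointwise dual (conjugate) exponent `p'`, `1/p + 1/p' = 1`. -/
def dualExp {α : Type*} (p : α → ℝ) : α → ℝ :=
  fun x => p x / (p x - 1)

/-- The norm of the a.e.-defined gradient of `f`. -/
def gradNorm {n : ℕ} (f : Eucl n → ℝ) : Eucl n → ℝ :=
  fun x => ‖fderiv ℝ f x‖

/-- The closed dyadic cube of generation `k` with lattice coordinates `z`. -/
def cubeQ {n : ℕ} (k : ℤ) (z : Fin n → ℤ) : Set (Eucl n) :=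
  {x | ∀ i, |x i - ((z i : ℝ) + 1 / 2) * (2:ℝ) ^ (-k)| ≤ (2:ℝ) ^ (-k) / 2}

/-- The expanded open cube `U = (17/16)·int(Q)`. -/
def cubeU {n : ℕ} (k : ℤ) (z : Fin n → ℤ) : Set (Eucl n) :=
  {x | ∀ i, |x i - ((z i : ℝ) + 1 / 2) * (2:ℝ) ^ (-k)| < (17 / 16) * ((2:ℝ) ^ (-k) / 2)}

/-- The dilation `K·Q` of the cube `Q` about its center. -/
def cubeDil {n : ℕ} (K : ℝ) (k : ℤ) (z : Fin n → ℤ) : Set (Eucl n) :=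
  {x | ∀ i, |x i - ((z i : ℝ) + 1 / 2) * (2:ℝ) ^ (-k)| ≤ K * ((2:ℝ) ^ (-k) / 2)}

/-- Distance between two sets. -/
def setDist {n : ℕ} (A B : Set (Eucl n)) : ℝ :=
  sInf (Set.image2 dist A B)

/-- A tree-covering of a bounded domain `Ω` obtained from a Whitney decomposition,
with `U_t = (17/16)·int(Q_t)` (Remark 3.2). -/
structure WhitneyTreeCovering (n : ℕ) (Ω : Set (Eucl n)) where
  ι : Type
  countable : Countable ι
  kk : ι → ℤ
  zz : ι → Fin n → ℤ
  disjQ : ∀ s t : ι, s ≠ t →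
    Disjoint (interior (cubeQ (kk s) (zz s))) (interior (cubeQ (kk t) (zz t)))
  unionQ : (⋃ t : ι, cubeQ (kk t) (zz t)) = Ω
  whitney₁ : ∀ t, Metric.diam (cubeQ (kk t) (zz t))
    ≤ setDist (cubeQ (kk t) (zz t)) (frontier Ω)
  whitney₂ : ∀ t, setDist (cubeQ (kk t) (zz t)) (frontier Ω)
    ≤ 4 * Metric.diam (cubeQ (kk t) (zz t))
  neighbor : ∀ s t : ι, (cubeQ (kk s) (zz s) ∩ cubeQ (kk t) (zz t)).Nonempty →
    Metric.diam (cubeQ (kk t) (zz t)) ≤ 4 * Metric.diam (cubeQ (kk s) (zz s))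
  root : ι
  parent : ι → ι
  parent_root : parent root = root
  reach : ∀ t : ι, ∃ m : ℕ, parent^[m] t = root
  C₁ : ℝ
  one_le_C₁ : 1 ≤ C₁
  cover : ∀ᵐ x ∂(volume : Measure (Eucl n)),
    (x ∈ Ω → 1 ≤ ∑' t : ι, Set.indicator (cubeU (kk t) (zz t)) (fun _ => (1:ℝ)) x) ∧
    (∑' t : ι, Set.indicator (cubeU (kk t) (zz t)) (fun _ => (1:ℝ)) x
      ≤ C₁ * Set.indicator Ω (fun _ => (1:ℝ)) x)
  Bt : ι → Set (Eucl n)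
  Bt_open : ∀ t, IsOpen (Bt t)
  Bt_sub : ∀ t, t ≠ root → Bt t ⊆ cubeU (kk t) (zz t) ∩ cubeU (kk (parent t)) (zz (parent t))
  Bt_disj : ∀ s t, s ≠ root → t ≠ root → s ≠ t → Disjoint (Bt s) (Bt t)
  C₂ : ℝ
  meas_ratio : ∀ t, t ≠ root →
    (volume (cubeU (kk t) (zz t))).toReal ≤ C₂ * (volume (Bt t)).toReal

/-- The Whitney cube `Q_t`. -/
def WhitneyTreeCovering.Q {n : ℕ} {Ω : Set (Eucl n)} (T : WhitneyTreeCovering n Ω)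
    (t : T.ι) : Set (Eucl n) := cubeQ (T.kk t) (T.zz t)

/-- The expanded cube `U_t`. -/
def WhitneyTreeCovering.U {n : ℕ} {Ω : Set (Eucl n)} (T : WhitneyTreeCovering n Ω)
    (t : T.ι) : Set (Eucl n) := cubeU (T.kk t) (T.zz t)

/-- The shadow `W_t = ⋃_{s ⪰ t} U_s`. -/
def WhitneyTreeCovering.shadow {n : ℕ} {Ω : Set (Eucl n)} (T : WhitneyTreeCovering n Ω)
    (t : T.ι) : Set (Eucl n) :=
  ⋃ s ∈ {s : T.ι | ∃ m : ℕ, T.parent^[m] s = t}, T.U s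

/-- The characteristic function of a set, as a real valued function. -/
def charFun {n : ℕ} (A : Set (Eucl n)) : Eucl n → ℝ :=
  Set.indicator A (fun _ => (1:ℝ))
/-- The off-diagonal averaging-type operator `T^α_{p(·)}` of Lemma 4.8. -/
def Tpa {n : ℕ} {Ω : Set (Eucl n)} (T : WhitneyTreeCovering n Ω)
    (p : Eucl n → ℝ) (α : ℝ) (f : Eucl n → ℝ) (x : Eucl n) : ℝ :=
  ∑' t : T.ι,
    Set.indicator (T.U t)
      (fun _ => (volume (T.U t)).toReal ^ (α / n)
        * (luxNorm Ω p (Set.indicator (T.U t) f) / luxNorm Ω p (charFun (T.U t)))) x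

theorem luxNorm_le_of_modular_le {n : ℕ} {A : Set (Eucl n)} {p f : Eucl n → ℝ} {l : ℝ}
    (hl : 0 < l) (h : ∫⁻ x in A, ENNReal.ofReal ((|f x| / l) ^ (p x)) ≤ 1) :
    luxNorm A p f ≤ l :=
  csInf_le ⟨0, fun _ hx => hx.1.le⟩ ⟨hl, h⟩

theorem luxNorm_nonneg {n : ℕ} (A : Set (Eucl n)) (p f : Eucl n → ℝ) : 0 ≤ luxNorm A p f :=
  Real.sInf_nonneg fun _ hx => hx.1.le

/-- The modular of a function cut off to `E` is the modular over `E`. -/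
theorem modular_indicator {n : ℕ} {Ω E : Set (Eucl n)} (hΩ : MeasurableSet Ω)
    (hE : MeasurableSet E) {p : Eucl n → ℝ} (hp1 : ∀ x ∈ Ω, 1 ≤ p x) (f : Eucl n → ℝ) (l : ℝ) :
    ∫⁻ x in Ω, ENNReal.ofReal ((|E.indicator f x| / l) ^ (p x)) =
      ∫⁻ x in E, ENNReal.ofReal ((|f x| / l) ^ (p x)) ∂(volume.restrict Ω) := by
  rw [← lintegral_indicator hE]
  refine setLIntegral_congr_fun hΩ fun x hx => ?_
  have := hp1 x hx
  by_cases h : x ∈ E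
  · simp [h]
  · simp [h, Real.zero_rpow (by linarith : p x ≠ 0)]

/-- If the modular of `f / l` over `E` is at most `w ≤ 1` and `p ≤ P` on `E`, then the norm of
`f` over `E` is at most `l * w ^ (1 / P)`. -/
theorem luxNorm_indicator_le {n : ℕ} {Ω E : Set (Eucl n)} (hΩ : MeasurableSet Ω)
    (hE : MeasurableSet E) {p f : Eucl n → ℝ} (hp1 : ∀ x ∈ Ω, 1 ≤ p x) {l w P : ℝ}
    (hl : 0 < l) (hw : 0 < w) (hw1 : w ≤ 1) (hP : 1 ≤ P)
    (hpP : ∀ᵐ x ∂(volume.restrict Ω), x ∈ E → p x ≤ P)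
    (hmod : ∫⁻ x in E, ENNReal.ofReal ((|f x| / l) ^ (p x)) ∂(volume.restrict Ω)
      ≤ ENNReal.ofReal w) :
    luxNorm Ω p (E.indicator f) ≤ l * w ^ (1 / P) := by
  have hwP : 0 < w ^ (1 / P) := Real.rpow_pos_of_pos hw _
  refine luxNorm_le_of_modular_le (by positivity) ?_
  rw [modular_indicator hΩ hE hp1]
  calc ∫⁻ x in E, ENNReal.ofReal ((|f x| / (l * w ^ (1 / P))) ^ (p x)) ∂(volume.restrict Ω)
      ≤ ∫⁻ x in E, ENNReal.ofReal w⁻¹ * ENNReal.ofReal ((|f x| / l) ^ (p x))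
          ∂(volume.restrict Ω) := by
        refine setLIntegral_mono_ae' hE ?_
        filter_upwards [hpP, ae_restrict_mem hΩ] with x hx hxΩ hxE
        have hxP := hx hxE
        have h1 := hp1 x hxΩ
        rw [← ENNReal.ofReal_mul (by positivity)]
        refine ENNReal.ofReal_le_ofReal ?_
        have : |f x| / (l * w ^ (1 / P)) = (w ^ (1 / P))⁻¹ * (|f x| / l) := by
          field_simp
        rw [this, Real.mul_rpow (by positivity) (by positivity)]
        refine mul_le_mul_of_nonneg_right ?_ (by positivity)
        rw [Real.inv_rpow hwP.le, ← Real.rpow_mul hw.le]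
        refine inv_anti₀ hw ?_
        calc w = w ^ (1:ℝ) := (Real.rpow_one w).symm
          _ ≤ w ^ (1 / P * p x) := by
            refine Real.rpow_le_rpow_of_exponent_ge hw hw1 ?_
            rw [one_div_mul_eq_div]
            exact (div_le_one (by linarith)).2 hxP
    _ = ENNReal.ofReal w⁻¹ * ∫⁻ x in E, ENNReal.ofReal ((|f x| / l) ^ (p x))
          ∂(volume.restrict Ω) := lintegral_const_mul' _ _ ENNReal.ofReal_ne_top
    _ ≤ ENNReal.ofReal w⁻¹ * ENNReal.ofReal w := by gcongr
    _ = 1 := by rw [← ENNReal.ofReal_mul (by positivity), inv_mul_cancel₀ hw.ne',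
                  ENNReal.ofReal_one]

/-- Lower bound for the norm of a characteristic function. -/
theorem le_luxNorm_charFun {n : ℕ} {Ω E : Set (Eucl n)} (hΩ : MeasurableSet Ω)
    (hE : MeasurableSet E) {p : Eucl n → ℝ} (hp1 : ∀ x ∈ Ω, 1 ≤ p x) {V P : ℝ}
    (hV : 0 < V) (hVE : volume.restrict Ω E = ENNReal.ofReal V) (hP : 1 ≤ P)
    (hpP : ∀ᵐ x ∂(volume.restrict Ω), x ∈ E → P ≤ p x) :
    min 1 (V ^ (1 / P)) ≤ luxNorm Ω p (charFun E) := by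
  have hmod : ∀ l : ℝ, ∫⁻ x in Ω, ENNReal.ofReal ((|charFun E x| / l) ^ (p x)) =
      ∫⁻ x in E, ENNReal.ofReal ((1 / l) ^ (p x)) ∂(volume.restrict Ω) := fun l => by
    simpa [_root_.charFun] using modular_indicator hΩ hE hp1 (fun _ => (1:ℝ)) l
  refine le_csInf ⟨max 1 V, by positivity, ?_⟩ ?_
  · rw [hmod]
    have hm : 0 < max 1 V := by positivity
    calc ∫⁻ x in E, ENNReal.ofReal ((1 / max 1 V) ^ (p x)) ∂(volume.restrict Ω)
        ≤ ∫⁻ x in E, ENNReal.ofReal (1 / max 1 V) ∂(volume.restrict Ω) := by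
          refine setLIntegral_mono_ae' hE ?_
          filter_upwards [ae_restrict_mem hΩ] with x hxΩ _
          refine ENNReal.ofReal_le_ofReal ?_
          calc (1 / max 1 V) ^ (p x) ≤ (1 / max 1 V) ^ (1:ℝ) :=
                Real.rpow_le_rpow_of_exponent_ge (by positivity)
                  ((div_le_one hm).2 (le_max_left _ _)) (hp1 x hxΩ)
            _ = _ := Real.rpow_one _
      _ = ENNReal.ofReal (1 / max 1 V * V) := by
          rw [setLIntegral_const, hVE, ← ENNReal.ofReal_mul (by positivity)]
      _ ≤ 1 := by
          rw [ENNReal.ofReal_le_one, one_div_mul_eq_div]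
          exact (div_le_one hm).2 (le_max_right _ _)
  · rintro l ⟨hl, hle⟩
    rw [hmod] at hle
    by_cases h1 : 1 ≤ l
    · exact (min_le_left _ _).trans h1
    refine (min_le_right _ _).trans ?_
    push Not at h1
    have key : ENNReal.ofReal ((1 / l) ^ P * V) ≤ 1 := by
      refine le_trans ?_ hle
      rw [ENNReal.ofReal_mul (by positivity), ← hVE, ← setLIntegral_const]
      refine setLIntegral_mono_ae' hE ?_
      filter_upwards [hpP] with x hx hxE
      exact ENNReal.ofReal_le_ofReal
        (Real.rpow_le_rpow_of_exponent_le ((one_le_div hl).2 h1.le) (hx hxE))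
    rw [ENNReal.ofReal_le_one, Real.div_rpow zero_le_one hl.le, Real.one_rpow,
      one_div_mul_eq_div, div_le_one (by positivity)] at key
    calc V ^ (1 / P) ≤ (l ^ P) ^ (1 / P) := Real.rpow_le_rpow hV.le key (by positivity)
      _ = l := by rw [← Real.rpow_mul hl.le, mul_one_div_cancel (by linarith), Real.rpow_one]

theorem rpow_one_div_mul_le_min {V W P r Δ c : ℝ} (hV : 0 < V) (hVW : V ≤ W) (hW : 1 ≤ W)
    (hP : 1 ≤ P) (hPr : P ≤ r) (hrΔ : r - P ≤ Δ) (hc : 0 < c) (hc1 : c ≤ 1) (hcV : c ≤ V ^ Δ) :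
    V ^ (1 / r) * (c / W) ≤ min 1 (V ^ (1 / P)) := by
  have hcW : c / W ≤ c := div_le_self hc.le hW
  have hr : 0 < r := by linarith
  rcases le_total 1 V with h | h
  · have h1 : V ^ (1 / r) ≤ W := by
      calc V ^ (1 / r) ≤ V ^ (1:ℝ) :=
            Real.rpow_le_rpow_of_exponent_le h ((div_le_one hr).2 (by linarith))
        _ ≤ W := by rwa [Real.rpow_one]
    rw [min_eq_left (Real.one_le_rpow h (by positivity))]
    calc V ^ (1 / r) * (c / W) ≤ W * (c / W) := by gcongr
      _ = c := by field_simp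
      _ ≤ 1 := hc1
  · refine le_min ?_ ?_
    · exact mul_le_one₀ (Real.rpow_le_one hV.le h (by positivity)) (by positivity)
        (hcW.trans hc1)
    · calc V ^ (1 / r) * (c / W) ≤ V ^ (1 / r) * V ^ Δ := by
            gcongr; exact hcW.trans hcV
        _ ≤ V ^ (1 / r) * V ^ (1 / P - 1 / r) := by
            gcongr 1
            refine Real.rpow_le_rpow_of_exponent_ge hV h ?_
            refine le_trans ?_ hrΔ
            rw [div_sub_div _ _ (by linarith) (by linarith), div_le_iff₀ (by positivity)]
            have : 1 ≤ P * r := by nlinarith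
            nlinarith
        _ = V ^ (1 / P) := by rw [← Real.rpow_add hV]; ring_nf

/-- The log-Hölder bound on the oscillation `Δ` keeps `V ^ Δ` away from zero. -/
theorem le_rpow_of_log_bound {n : ℕ} {s κ V Δ M C₀ : ℝ} (hs : 0 < s) (hκ : 0 < κ) (hκ1 : κ ≤ 1)
    (hV : κ * s ^ n ≤ V) (hΔ : 0 ≤ Δ) (hΔM : Δ ≤ M) (hC₀ : 0 < C₀)
    (hlog : s ≤ 1 / 2 → Δ ≤ C₀ / (-Real.log s)) :
    (κ * (1 / 2) ^ n) ^ M * Real.exp (-(n * C₀)) ≤ V ^ Δ := by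
  have hb1 : (1 / 2 : ℝ) ^ n ≤ 1 := pow_le_one₀ (by norm_num) (by norm_num)
  have hb0 : (0 : ℝ) < (1 / 2 : ℝ) ^ n := by positivity
  have hκb : κ * (1 / 2) ^ n ≤ 1 := mul_le_one₀ hκ1 hb0.le hb1
  by_cases h : s ≤ 1 / 2
  · have hls : 0 < -Real.log s := by
      have := Real.log_neg hs (by linarith); linarith
    have h2 := (le_div_iff₀ hls).1 (hlog h)
    calc (κ * (1 / 2) ^ n) ^ M * Real.exp (-(n * C₀)) ≤ κ ^ Δ * (s ^ n) ^ Δ := by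
          refine mul_le_mul ?_ ?_ (Real.exp_pos _).le (by positivity)
          · calc (κ * (1 / 2) ^ n) ^ M ≤ κ ^ M := by
                  refine Real.rpow_le_rpow (by positivity) ?_ (by linarith)
                  nlinarith
              _ ≤ κ ^ Δ := Real.rpow_le_rpow_of_exponent_ge hκ hκ1 hΔM
          · rw [← Real.rpow_natCast, ← Real.rpow_mul hs.le, Real.rpow_def_of_pos hs]
            refine Real.exp_le_exp.2 ?_
            have : (n : ℝ) * (Δ * -Real.log s) ≤ n * C₀ := by gcongr
            linarith
      _ = (κ * s ^ n) ^ Δ := (Real.mul_rpow hκ.le (by positivity)).symm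
      _ ≤ V ^ Δ := Real.rpow_le_rpow (by positivity) hV hΔ
  · push Not at h
    calc (κ * (1 / 2) ^ n) ^ M * Real.exp (-(n * C₀)) ≤ (κ * (1 / 2) ^ n) ^ M * 1 := by
          gcongr
          rw [Real.exp_le_one_iff]
          have : 0 ≤ (n : ℝ) * C₀ := by positivity
          linarith
      _ ≤ (κ * (1 / 2) ^ n) ^ Δ := by
          rw [mul_one]
          exact Real.rpow_le_rpow_of_exponent_ge (by positivity) hκb hΔM
      _ ≤ V ^ Δ := by
          refine Real.rpow_le_rpow (by positivity) (le_trans ?_ hV) hΔ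
          gcongr

theorem sum_div_rpow_le_sum_rpow {ι : Type*} {S : Finset ι} (hS : S.Nonempty) {c : ι → ℝ}
    (hc : ∀ t ∈ S, 0 ≤ c t) {C B r : ℝ} (hB : 0 < B) (hcard : (S.card : ℝ) ≤ C) (hr : 0 < r) :
    ((∑ t ∈ S, c t) / (C * B)) ^ r ≤ ∑ t ∈ S, (c t / B) ^ r := by
  obtain ⟨t₀, ht₀, hmax⟩ := S.exists_max_image c hS
  have hC : 0 < C := lt_of_lt_of_le (by exact_mod_cast hS.card_pos) hcard
  have hsum : ∑ t ∈ S, c t ≤ C * c t₀ := by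
    calc ∑ t ∈ S, c t ≤ S.card • c t₀ := Finset.sum_le_card_nsmul _ _ _ hmax
      _ = S.card * c t₀ := nsmul_eq_mul _ _
      _ ≤ C * c t₀ := mul_le_mul_of_nonneg_right hcard (hc _ ht₀)
  calc ((∑ t ∈ S, c t) / (C * B)) ^ r ≤ (c t₀ / B) ^ r := by
        refine Real.rpow_le_rpow (div_nonneg (Finset.sum_nonneg hc) (by positivity)) ?_ hr.le
        rw [div_le_div_iff₀ (by positivity) hB]
        nlinarith
    _ ≤ ∑ t ∈ S, (c t / B) ^ r :=
        Finset.single_le_sum (f := fun t => (c t / B) ^ r)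
          (fun t ht => Real.rpow_nonneg (div_nonneg (hc t ht) hB.le) _) ht₀

/-- The center of the cubes `cubeQ k z` and `cubeU k z`. -/
def cubeCenter {n : ℕ} (k : ℤ) (z : Fin n → ℤ) : Eucl n :=
  WithLp.toLp 2 fun i => ((z i : ℝ) + 1 / 2) * (2:ℝ) ^ (-k)

theorem cubeCenter_mem_cubeQ {n : ℕ} (k : ℤ) (z : Fin n → ℤ) : cubeCenter k z ∈ cubeQ k z := by
  intro i
  simp only [cubeCenter, sub_self, abs_zero]
  positivity

theorem isOpen_cubeU {n : ℕ} (k : ℤ) (z : Fin n → ℤ) : IsOpen (cubeU k z) := by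
  simp only [cubeU, ofPred_forall]
  refine isOpen_iInter_of_finite fun i => isOpen_lt ?_ continuous_const
  fun_prop

theorem volume_cubeQ {n : ℕ} (k : ℤ) (z : Fin n → ℤ) :
    volume (cubeQ k z) = ENNReal.ofReal (((2:ℝ) ^ (-k)) ^ n) := by
  have h : cubeQ k z = (@WithLp.ofLp 2 (Fin n → ℝ)) ⁻¹'
      (Set.pi univ fun i => closedBall (((z i : ℝ) + 1 / 2) * (2:ℝ) ^ (-k)) ((2:ℝ) ^ (-k) / 2)) := by
    ext x
    simp [cubeQ, Real.dist_eq]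
  rw [h, (PiLp.volume_preserving_ofLp (Fin n)).measure_preimage
    (MeasurableSet.univ_pi fun i => measurableSet_closedBall).nullMeasurableSet, volume_pi_pi]
  simp only [Real.volume_closedBall]
  rw [Finset.prod_const, ← ENNReal.ofReal_pow (by positivity)]
  simp [mul_div_cancel₀]

theorem volume_cubeU {n : ℕ} (k : ℤ) (z : Fin n → ℤ) :
    volume (cubeU k z) = ENNReal.ofReal ((17 / 16 * (2:ℝ) ^ (-k)) ^ n) := by
  have h : cubeU k z = (@WithLp.ofLp 2 (Fin n → ℝ)) ⁻¹'
      (Set.pi univ fun i => ball (((z i : ℝ) + 1 / 2) * (2:ℝ) ^ (-k))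
        (17 / 16 * ((2:ℝ) ^ (-k) / 2))) := by
    ext x
    simp [cubeU, Real.dist_eq]
  rw [h, (PiLp.volume_preserving_ofLp (Fin n)).measure_preimage
    (MeasurableSet.univ_pi fun i => measurableSet_ball).nullMeasurableSet, volume_pi_pi]
  simp only [Real.volume_ball]
  rw [Finset.prod_const, ← ENNReal.ofReal_pow (by positivity)]
  congr 2
  · ring
  · simp

theorem cubeQ_subset_cubeU {n : ℕ} (k : ℤ) (z : Fin n → ℤ) : cubeQ k z ⊆ cubeU k z := by
  intro x hx i
  have : (0:ℝ) < (2:ℝ) ^ (-k) := by positivity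
  have := hx i
  linarith

theorem diam_cubeQ_le {n : ℕ} (k : ℤ) (z : Fin n → ℤ) :
    diam (cubeQ k z) ≤ n * (2:ℝ) ^ (-k) := by
  have hl : (0:ℝ) < (2:ℝ) ^ (-k) := by positivity
  refine diam_le_of_forall_dist_le (by positivity) fun x hx y hy => ?_
  rw [EuclideanSpace.dist_eq]
  refine Real.sqrt_le_iff.2 ⟨by positivity, ?_⟩
  calc ∑ i, dist (x i) (y i) ^ 2 ≤ ∑ _i : Fin n, ((2:ℝ) ^ (-k)) ^ 2 := by
        refine Finset.sum_le_sum fun i _ => ?_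
        refine pow_le_pow_left₀ dist_nonneg ?_ 2
        rw [Real.dist_eq, abs_le]
        have h1 := abs_le.1 (hx i)
        have h2 := abs_le.1 (hy i)
        constructor <;> linarith
    _ = n * ((2:ℝ) ^ (-k)) ^ 2 := by simp
    _ ≤ (n * (2:ℝ) ^ (-k)) ^ 2 := by
        rw [mul_pow]
        have : (n : ℝ) ≤ (n : ℝ) ^ 2 := by exact_mod_cast Nat.le_self_pow two_ne_zero n
        gcongr

/-- Points of the expanded cube are closer to the center than the diameter of the cube. -/
theorem dist_cubeCenter_le {n : ℕ} {k : ℤ} {z : Fin n → ℤ}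
    (hb : Bornology.IsBounded (cubeQ k z)) {x : Eucl n} (hx : x ∈ cubeU k z) :
    dist x (cubeCenter k z) ≤ 17 / 32 * diam (cubeQ k z) := by
  set c := cubeCenter k z with hc
  have hmem : ∀ ε : ℝ, |ε| ≤ 16 / 17 → c + ε • (x - c) ∈ cubeQ k z := by
    intro ε hε i
    have hxi := hx i
    have : (c + ε • (x - c)) i - ((z i : ℝ) + 1 / 2) * (2:ℝ) ^ (-k) =
        ε * (x i - ((z i : ℝ) + 1 / 2) * (2:ℝ) ^ (-k)) := by
      simp [hc, cubeCenter]
    rw [this, abs_mul]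
    calc _ ≤ 16 / 17 * (17 / 16 * ((2:ℝ) ^ (-k) / 2)) :=
          mul_le_mul hε hxi.le (abs_nonneg _) (by norm_num)
      _ = _ := by ring
  have h := dist_le_diam_of_mem hb (hmem (16 / 17) (by norm_num [abs_of_pos]))
    (hmem (-(16 / 17)) (by norm_num [abs_of_pos]))
  have h2 : (c + (16 / 17 : ℝ) • (x - c)) - (c + (-(16 / 17) : ℝ) • (x - c)) =
      (32 / 17 : ℝ) • (x - c) := by
    module
  rw [dist_eq_norm, h2, norm_smul, Real.norm_of_nonneg (by norm_num), ← dist_eq_norm] at h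
  linarith

theorem setDist_le_infDist {n : ℕ} {A B : Set (Eucl n)} {x : Eucl n} (hx : x ∈ A)
    (hB : B.Nonempty) : setDist A B ≤ infDist x B := by
  refine (le_infDist hB).2 fun {y} hy => ?_
  refine csInf_le ⟨0, ?_⟩ (mem_image2_of_mem hx hy)
  rintro _ ⟨a, _, b, _, rfl⟩
  exact dist_nonneg

theorem infDist_le_setDist_add_diam {n : ℕ} {A B : Set (Eucl n)} (hA : Bornology.IsBounded A)
    {x : Eucl n} (hx : x ∈ A) (hB : B.Nonempty) : infDist x B ≤ setDist A B + diam A := by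
  rw [← sub_le_iff_le_add]
  refine le_csInf (Set.Nonempty.image2 ⟨x, hx⟩ hB) ?_
  rintro _ ⟨a, ha, b, hb, rfl⟩
  have h1 := infDist_le_dist_of_mem (x := x) hb
  have h2 := dist_triangle x a b
  have h3 := dist_le_diam_of_mem hA hx ha
  linarith

theorem frontier_nonempty_of_isBounded {n : ℕ} (hn : 0 < n) {Ω : Set (Eucl n)}
    (hne : Ω.Nonempty) (hb : Bornology.IsBounded Ω) : (frontier Ω).Nonempty := by
  have : Nonempty (Fin n) := ⟨⟨0, hn⟩⟩
  refine nonempty_frontier_iff.2 ⟨hne, ?_⟩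
  rintro rfl
  exact NormedSpace.unbounded_univ ℝ (Eucl n) hb

theorem exponent_bounds {n : ℕ} {A E : Set (Eucl n)} (hEA : E ⊆ A) {Ω : Set (Eucl n)}
    (hΩ : MeasurableSet Ω) (hA : MeasurableSet A) {p : Eucl n → ℝ} {M : ℝ}
    (hp1 : ∀ x ∈ Ω, 1 ≤ p x) (hpM : ∀ᵐ x ∂(volume.restrict Ω), p x ≤ M)
    (hE : volume.restrict Ω E ≠ 0) :
    1 ≤ essInfOn p (A ∩ Ω) ∧ essInfOn p (A ∩ Ω) ≤ essSupOn p (A ∩ Ω) ∧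
      essSupOn p (A ∩ Ω) ≤ M ∧
      (∀ᵐ x ∂(volume.restrict Ω), x ∈ E → essInfOn p (A ∩ Ω) ≤ p x) ∧
      (∀ᵐ x ∂(volume.restrict Ω), x ∈ E → p x ≤ essSupOn p (A ∩ Ω)) := by
  have hres : volume.restrict (A ∩ Ω) = (volume.restrict Ω).restrict A :=
    (Measure.restrict_restrict hA).symm
  have hne : volume.restrict (A ∩ Ω) ≠ (0 : Measure (Eucl n)) := by
    rw [hres, Ne, Measure.restrict_eq_zero]
    exact fun h => hE (measure_mono_null hEA h)
  have : (ae (volume.restrict (A ∩ Ω))).NeBot := ae_neBot.2 hne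
  have h1 : ∀ᵐ x ∂(volume.restrict (A ∩ Ω)), 1 ≤ p x := by
    filter_upwards [ae_restrict_mem (hA.inter hΩ)] with x hx using hp1 x hx.2
  have h2 : ∀ᵐ x ∂(volume.restrict (A ∩ Ω)), p x ≤ M := by
    rw [hres]; exact ae_restrict_of_ae hpM
  have hba : IsBoundedUnder (· ≤ ·) (ae (volume.restrict (A ∩ Ω))) p := ⟨M, h2⟩
  have hbb : IsBoundedUnder (· ≥ ·) (ae (volume.restrict (A ∩ Ω))) p := ⟨1, h1⟩
  have h3 : ∀ᵐ x ∂(volume.restrict (A ∩ Ω)), p x ≤ essSupOn p (A ∩ Ω) := ae_le_essSup hba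
  have h4 : ∀ᵐ x ∂(volume.restrict (A ∩ Ω)), essInfOn p (A ∩ Ω) ≤ p x := ae_essInf_le hbb
  refine ⟨le_essInf_of_ae_le _ h1 hba.isCoboundedUnder_ge, ?_,
    essSup_le_of_ae_le _ h2 hbb.isCoboundedUnder_le, ?_, ?_⟩
  · obtain ⟨x, hx⟩ := (h3.and h4).exists
    exact hx.2.trans hx.1
  · rw [hres, ae_restrict_iff' hA] at h4
    filter_upwards [h4] with x hx hxE using hx (hEA hxE)
  · rw [hres, ae_restrict_iff' hA] at h3
    filter_upwards [h3] with x hx hxE using hx (hEA hxE)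

/-- The elementary inequality behind the pointwise bound of a single term of `Tpa`. -/
theorem term_rpow_le {ν : ℝ} {α β V W D c l w P r qx U N L A K : ℝ} (hν : 0 < ν)
    (hα : α < ν) (hβ0 : 0 < β) (hβα : β < α) (hV : 0 < V) (hVW : V ≤ W) (hW : 1 ≤ W)
    (hD : 1 ≤ D) (hU0 : 0 ≤ U) (hU : U ≤ D * V) (hc : 0 < c) (hl : 0 < l) (hw : 0 < w)
    (hw1 : w ≤ 1) (hP : 1 ≤ P) (hqx : 0 < qx) (hqr : 1 / r - 1 / qx = β / ν)
    (hN0 : 0 ≤ N) (hN : N ≤ l * w ^ (1 / P)) (hL : V ^ (1 / r) * (c / W) ≤ L)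
    (hA : A = D * W * W / c) (hK : 1 ≤ K) (hq1 : 1 ≤ qx) (hPq : P ≤ qx ∨ w = 1) :
    (U ^ (α / ν) * (N / L) / (K * (A * l))) ^ qx ≤ K⁻¹ * (V⁻¹ * w) := by
  have hr0 : 0 < V ^ (1 / r) * (c / W) := by positivity
  have hL0 : 0 < L := hr0.trans_le hL
  have hA0 : 0 < A := by rw [hA]; positivity
  have hα0 : 0 < α / ν := div_pos (by linarith) hν
  have hα1 : α / ν ≤ 1 := (div_le_one hν).2 hα.le
  have hUα : U ^ (α / ν) ≤ D * V ^ (α / ν) := by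
    calc U ^ (α / ν) ≤ (D * V) ^ (α / ν) := Real.rpow_le_rpow hU0 hU hα0.le
      _ = D ^ (α / ν) * V ^ (α / ν) := Real.mul_rpow (by linarith) hV.le
      _ ≤ D ^ (1:ℝ) * V ^ (α / ν) := by gcongr
      _ = D * V ^ (α / ν) := by rw [Real.rpow_one]
  have hVexp : V ^ (α / ν) = V ^ ((α - β) / ν) * V ^ (-(1 / qx)) * V ^ (1 / r) := by
    rw [← Real.rpow_add hV, ← Real.rpow_add hV]
    congr 1
    have : 1 / r = β / ν + 1 / qx := by linarith
    rw [this]; ring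
  have hVW' : V ^ ((α - β) / ν) ≤ W := by
    have h0 : 0 ≤ (α - β) / ν := div_nonneg (by linarith) hν.le
    calc V ^ ((α - β) / ν) ≤ W ^ ((α - β) / ν) := Real.rpow_le_rpow hV.le hVW h0
      _ ≤ W ^ (1:ℝ) := Real.rpow_le_rpow_of_exponent_le hW
          ((div_le_one hν).2 (by linarith))
      _ = W := Real.rpow_one W
  have hbase : U ^ (α / ν) * (N / L) / (A * l) ≤ V ^ (-(1 / qx)) * w ^ (1 / P) := by
    rw [div_le_iff₀ (by positivity)]
    calc U ^ (α / ν) * (N / L)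
        ≤ (D * V ^ (α / ν)) * (l * w ^ (1 / P) / (V ^ (1 / r) * (c / W))) := by
          gcongr
      _ = V ^ ((α - β) / ν) * (D * V ^ (-(1 / qx)) * (l * w ^ (1 / P)) * W / c) := by
          rw [hVexp]; field_simp
      _ ≤ W * (D * V ^ (-(1 / qx)) * (l * w ^ (1 / P)) * W / c) := by gcongr
      _ = V ^ (-(1 / qx)) * w ^ (1 / P) * (A * l) := by rw [hA]; field_simp
  have hX0 : 0 ≤ U ^ (α / ν) * (N / L) / (A * l) := by positivity
  have hsplit : U ^ (α / ν) * (N / L) / (K * (A * l)) =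
      K⁻¹ * (U ^ (α / ν) * (N / L) / (A * l)) := by field_simp
  have hK0 : 0 < K := by linarith
  rw [hsplit, Real.mul_rpow (by positivity) hX0]
  refine mul_le_mul ?_ ?_ (by positivity) (by positivity)
  · calc K⁻¹ ^ qx ≤ K⁻¹ ^ (1:ℝ) :=
          Real.rpow_le_rpow_of_exponent_ge (by positivity) (inv_le_one_of_one_le₀ hK) hq1
      _ = K⁻¹ := Real.rpow_one _
  · calc (U ^ (α / ν) * (N / L) / (A * l)) ^ qx ≤ (V ^ (-(1 / qx)) * w ^ (1 / P)) ^ qx :=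
          Real.rpow_le_rpow hX0 hbase hqx.le
      _ = V⁻¹ * w ^ (qx / P) := by
          rw [Real.mul_rpow (by positivity) (by positivity), ← Real.rpow_mul hV.le,
            ← Real.rpow_mul hw.le, neg_mul, one_div_mul_cancel hqx.ne', Real.rpow_neg_one]
          congr 2; ring
      _ ≤ V⁻¹ * w := by
          gcongr
          rcases hPq with h | h
          · calc w ^ (qx / P) ≤ w ^ (1:ℝ) := Real.rpow_le_rpow_of_exponent_ge hw hw1
                  ((one_le_div (by linarith)).2 h)
              _ = w := Real.rpow_one w
          · simp [h]

/-- Almost every point of `Ω` lies in at least one and at most `C₁` of the sets `U_t`. -/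
theorem WhitneyTreeCovering.ae_finite_overlap {n : ℕ} {Ω : Set (Eucl n)}
    (T : WhitneyTreeCovering n Ω) (hΩ : MeasurableSet Ω) :
    ∀ᵐ x ∂(volume.restrict Ω), ∃ S : Finset T.ι, S.Nonempty ∧ (S.card : ℝ) ≤ T.C₁ ∧
      ∀ t, t ∈ S ↔ x ∈ T.U t := by
  filter_upwards [ae_restrict_of_ae T.cover, ae_restrict_mem hΩ] with x hx hxΩ
  have h1 := hx.1 hxΩ
  have h2 := hx.2
  rw [indicator_of_mem hxΩ, mul_one] at h2
  have hsum : Summable fun t : T.ι =>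
      Set.indicator (cubeU (T.kk t) (T.zz t)) (fun _ => (1:ℝ)) x := by
    by_contra h
    rw [tsum_eq_zero_of_not_summable h] at h1
    linarith
  have hfin : {t : T.ι | x ∈ T.U t}.Finite := by
    have := hsum.tendsto_cofinite_zero.eventually (gt_mem_nhds (zero_lt_one' ℝ))
    refine (Filter.eventually_cofinite.1 this).subset fun t ht => ?_
    have ht' : x ∈ cubeU (T.kk t) (T.zz t) := ht
    simp [ht']
  have hmem : ∀ t, t ∈ hfin.toFinset ↔ x ∈ cubeU (T.kk t) (T.zz t) := fun t => by
    simp [WhitneyTreeCovering.U]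
  have hcard : ∑' t : T.ι, Set.indicator (cubeU (T.kk t) (T.zz t)) (fun _ => (1:ℝ)) x =
      hfin.toFinset.card := by
    rw [tsum_eq_sum (s := hfin.toFinset)
      fun t ht => indicator_of_notMem (fun h => ht ((hmem t).2 h)) _,
      Finset.sum_congr rfl fun t ht => indicator_of_mem ((hmem t).1 ht) _]
    simp
  rw [hcard] at h1 h2
  refine ⟨hfin.toFinset, ?_, h2, hmem⟩
  rw [← Finset.card_pos]
  exact_mod_cast (lt_of_lt_of_le zero_lt_one h1)

/-- Integrals over the sets `U_t` add up to at most `C₁` times the integral over `Ω`. -/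
theorem WhitneyTreeCovering.tsum_setLIntegral_le {n : ℕ} {Ω : Set (Eucl n)}
    (T : WhitneyTreeCovering n Ω) (hΩ : MeasurableSet Ω) {F : Eucl n → ENNReal}
    (hF : Measurable F) :
    ∑' t, ∫⁻ x in T.U t, F x ∂(volume.restrict Ω) ≤
      ENNReal.ofReal T.C₁ * ∫⁻ x in Ω, F x := by
  have := T.countable
  have hU : ∀ t, MeasurableSet (T.U t) := fun t => (isOpen_cubeU _ _).measurableSet
  simp_rw [← fun t => lintegral_indicator (μ := volume.restrict Ω) (hU t) F]
  rw [← lintegral_tsum fun t => (hF.indicator (hU t)).aemeasurable,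
    ← lintegral_const_mul _ hF]
  refine lintegral_mono_ae ?_
  filter_upwards [T.ae_finite_overlap hΩ] with x ⟨S, _, hcard, hS⟩
  rw [tsum_eq_sum (s := S) fun t ht => indicator_of_notMem (fun h => ht ((hS t).2 h)) _,
    Finset.sum_congr rfl fun t ht => indicator_of_mem ((hS t).1 ht) _, Finset.sum_const,
    nsmul_eq_mul]
  gcongr
  rw [← ENNReal.ofReal_natCast]
  exact ENNReal.ofReal_le_ofReal hcard

/-- Geometry of the sets `U_t` relative to the distance to the boundary. -/
theorem WhitneyTreeCovering.geometry {n : ℕ} (hn : 0 < n) {Ω : Set (Eucl n)} (hΩo : IsOpen Ω)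
    (hΩb : Bornology.IsBounded Ω) (T : WhitneyTreeCovering n Ω) {τ : ℝ} (hτ : 1 ≤ τ) (t : T.ι) :
    ∃ x ∈ Ω, 0 < τ * bdist Ω x ∧ T.U t ⊆ ballB Ω τ x ∧
      (1 / (5 * n * τ)) ^ n * (τ * bdist Ω x) ^ n ≤ (volume.restrict Ω (T.U t)).toReal ∧
      (volume (T.U t)).toReal ≤ (17 / 16) ^ n * (volume.restrict Ω (T.U t)).toReal ∧
      0 < (volume.restrict Ω (T.U t)).toReal := by
  have hQΩ : cubeQ (T.kk t) (T.zz t) ⊆ Ω := by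
    conv_rhs => rw [← T.unionQ]
    exact subset_iUnion (fun t => cubeQ (T.kk t) (T.zz t)) t
  have hQb := hΩb.subset hQΩ
  set x := cubeCenter (T.kk t) (T.zz t)
  have hxQ : x ∈ cubeQ (T.kk t) (T.zz t) := cubeCenter_mem_cubeQ _ _
  have hxΩ := hQΩ hxQ
  have hfr := frontier_nonempty_of_isBounded hn ⟨x, hxΩ⟩ hΩb
  have hd : 0 < bdist Ω x := by
    refine (isClosed_frontier.notMem_iff_infDist_pos hfr).1 fun h => ?_
    rw [hΩo.frontier_eq] at h
    exact h.2 hxΩ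
  have hlow := (T.whitney₁ t).trans (setDist_le_infDist hxQ hfr)
  have hupp := infDist_le_setDist_add_diam hQb hxQ hfr
  have hw2 := T.whitney₂ t
  have hdiam := diam_cubeQ_le (T.kk t) (T.zz t)
  have hside : (0:ℝ) < (2:ℝ) ^ (-T.kk t) := by positivity
  have hn0 : (0:ℝ) < n := by exact_mod_cast hn
  have hτ0 : 0 < τ := by linarith
  have hV : ((2:ℝ) ^ (-T.kk t)) ^ n ≤ (volume.restrict Ω (T.U t)).toReal := by
    rw [← ENNReal.ofReal_le_iff_le_toReal]
    · rw [← volume_cubeQ (T.kk t) (T.zz t), Measure.restrict_apply' hΩo.measurableSet]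
      exact measure_mono (subset_inter (cubeQ_subset_cubeU _ _) hQΩ)
    · refine ne_top_of_le_ne_top ?_ (Measure.restrict_apply_le Ω (T.U t))
      rw [WhitneyTreeCovering.U, volume_cubeU]
      exact ENNReal.ofReal_ne_top
  refine ⟨x, hxΩ, by positivity, ?_, ?_, ?_, lt_of_lt_of_le (by positivity) hV⟩
  · intro y hy
    have h := dist_cubeCenter_le hQb hy
    have h' : diam (cubeQ (T.kk t) (T.zz t)) ≤ bdist Ω x := hlow
    rw [ballB, mem_ball]
    nlinarith
  · refine le_trans ?_ hV
    rw [← mul_pow]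
    refine pow_le_pow_left₀ (by positivity) ?_ n
    have h' : bdist Ω x ≤ 5 * (n * (2:ℝ) ^ (-T.kk t)) := by
      change infDist x (frontier Ω) ≤ _
      linarith
    rw [one_div_mul_eq_div, div_le_iff₀ (by positivity)]
    calc τ * bdist Ω x ≤ τ * (5 * (n * (2:ℝ) ^ (-T.kk t))) := by gcongr
      _ = _ := by ring
  · rw [WhitneyTreeCovering.U, volume_cubeU, ENNReal.toReal_ofReal (by positivity), mul_pow]
    gcongr
    exact hV

/-- Uniform modular bound for the single terms of `Tpa`. -/
theorem WhitneyTreeCovering.exists_term_modular_le {n : ℕ} {Ω : Set (Eucl n)} (hΩo : IsOpen Ω)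
    (hΩb : Bornology.IsBounded Ω) (T : WhitneyTreeCovering n Ω)
    {α : ℝ} (hαn : α < n) {p q : Eucl n → ℝ}
    (hp1 : ∀ x ∈ Ω, 1 ≤ p x) (hq1 : ∀ x ∈ Ω, 1 ≤ q x)
    (hpb : ∃ M : ℝ, ∀ᵐ x ∂(volume.restrict Ω), p x ≤ M)
    {β : ℝ} (hβ0 : 0 < β) (hβα : β < α)
    (hpq : ∀ᵐ x ∂(volume.restrict Ω), 1 / p x - 1 / q x = β / n)
    {τ : ℝ} (hτ : 1 ≤ τ) {C₀ : ℝ} (hC₀ : 0 < C₀) (hLH : BoundaryLH Ω p τ C₀) :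
    ∃ A K : ℝ, 0 < A ∧ 0 < K ∧ ∀ (t : T.ι) (f : Eucl n → ℝ) (l L : ℝ), 0 < l → 1 ≤ L →
      ∫⁻ x in Ω, ENNReal.ofReal ((|f x| / l) ^ (p x)) ≤ 1 →
      ∫⁻ x in T.U t, ENNReal.ofReal (((volume (T.U t)).toReal ^ (α / n)
          * (luxNorm Ω p ((T.U t).indicator f) / luxNorm Ω p (charFun (T.U t)))
          / (L * (A * l))) ^ (q x)) ∂(volume.restrict Ω) ≤
        ENNReal.ofReal L⁻¹ *
          (∫⁻ x in T.U t, ENNReal.ofReal ((|f x| / l) ^ (p x)) ∂(volume.restrict Ω) +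
            ENNReal.ofReal K * volume.restrict Ω (T.U t)) := by
  have hΩ := hΩo.measurableSet
  have hν : (0:ℝ) < n := by linarith
  have hn : 0 < n := by exact_mod_cast hν
  obtain ⟨M₀, hM₀⟩ := hpb
  obtain ⟨M, hM1, hM⟩ : ∃ M : ℝ, 1 ≤ M ∧ ∀ᵐ x ∂(volume.restrict Ω), p x ≤ M :=
    ⟨max 1 M₀, le_max_left _ _, hM₀.mono fun x hx => hx.trans (le_max_right _ _)⟩
  have hΩfin : volume Ω ≠ ⊤ := hΩb.measure_lt_top.ne
  obtain ⟨W, hW⟩ : ∃ W, W = max 1 (volume Ω).toReal := ⟨_, rfl⟩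
  have hW1 : 1 ≤ W := hW ▸ le_max_left _ _
  obtain ⟨κ, hκ⟩ : ∃ κ : ℝ, κ = (1 / (5 * n * τ)) ^ n := ⟨_, rfl⟩
  have hτ0 : 0 < τ := by linarith
  have hκ0 : 0 < κ := by rw [hκ]; positivity
  have hκ1 : κ ≤ 1 := by
    have h1n : (1:ℝ) ≤ n := by exact_mod_cast hn
    rw [hκ]
    refine pow_le_one₀ (by positivity) ((div_le_one (by positivity)).2 ?_)
    nlinarith
  obtain ⟨c, hc⟩ : ∃ c, c = (κ * (1 / 2) ^ n) ^ M * Real.exp (-(n * C₀)) := ⟨_, rfl⟩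
  have hc0 : 0 < c := by rw [hc]; positivity
  have hc1 : c ≤ 1 := by
    rw [hc]
    refine mul_le_one₀ (Real.rpow_le_one (by positivity) ?_ (by linarith)) (Real.exp_pos _).le ?_
    · exact mul_le_one₀ hκ1 (by positivity) (pow_le_one₀ (by norm_num) (by norm_num))
    · rw [Real.exp_le_one_iff]
      have : 0 ≤ (n : ℝ) * C₀ := by positivity
      linarith
  obtain ⟨s₀, hs₀⟩ : ∃ s₀, s₀ = min (1 / 2) (Real.exp (-(C₀ * n / β))) := ⟨_, rfl⟩
  have hs₀0 : 0 < s₀ := hs₀ ▸ lt_min (by norm_num) (Real.exp_pos _)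
  have hD : (1:ℝ) ≤ (17 / 16) ^ n := one_le_pow₀ (by norm_num)
  refine ⟨(17 / 16) ^ n * W * W / c, 1 / (κ * s₀ ^ n), by positivity, by positivity, ?_⟩
  intro t f l L hl hL hmod
  obtain ⟨x₀, hx₀, hs, hsub, hVs, hUV, hV⟩ := T.geometry hn hΩo hΩb hτ t
  have hU : MeasurableSet (T.U t) := (isOpen_cubeU _ _).measurableSet
  rw [← hκ] at hVs
  have hVle : volume.restrict Ω (T.U t) ≤ volume Ω := by
    rw [Measure.restrict_apply' hΩ]
    exact measure_mono inter_subset_right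
  have hVfin : volume.restrict Ω (T.U t) ≠ ⊤ := ne_top_of_le_ne_top hΩfin hVle
  have hVE : volume.restrict Ω (T.U t) =
      ENNReal.ofReal (volume.restrict Ω (T.U t)).toReal := (ENNReal.ofReal_toReal hVfin).symm
  have hVW : (volume.restrict Ω (T.U t)).toReal ≤ W :=
    (ENNReal.toReal_mono hΩfin hVle).trans (hW ▸ le_max_right _ _)
  obtain ⟨h1P, hPP, hPM, hPp, hpP⟩ := exponent_bounds hsub hΩ
    (measurableSet_ball : MeasurableSet (ballB Ω τ x₀)) hp1 hM
    (fun h => by rw [h] at hV; simp at hV)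
  have hosc := hLH x₀ hx₀
  generalize (volume.restrict Ω (T.U t)).toReal = V at *
  generalize essInfOn p (ballB Ω τ x₀ ∩ Ω) = P₁ at *
  generalize essSupOn p (ballB Ω τ x₀ ∩ Ω) = P₂ at *
  generalize τ * bdist Ω x₀ = s at *
  have hcV : c ≤ V ^ (P₂ - P₁) :=
    hc ▸ le_rpow_of_log_bound hs hκ0 hκ1 hVs (by linarith) (by linarith) hC₀ hosc
  have hm1 : ∫⁻ x in T.U t, ENNReal.ofReal ((|f x| / l) ^ (p x)) ∂(volume.restrict Ω) ≤ 1 :=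
    (setLIntegral_le_lintegral _ _).trans hmod
  have hmE := (ENNReal.ofReal_toReal (ne_top_of_le_ne_top ENNReal.one_ne_top hm1)).symm
  generalize hmdef : (∫⁻ x in T.U t, ENNReal.ofReal ((|f x| / l) ^ (p x))
    ∂(volume.restrict Ω)).toReal = m at hmE
  have hm0 : 0 ≤ m := hmdef ▸ ENNReal.toReal_nonneg
  rw [hmE, ENNReal.ofReal_le_one] at hm1
  obtain ⟨w, hw⟩ : ∃ w, w = min 1 (m + 1 / (κ * s₀ ^ n) * V) := ⟨_, rfl⟩
  have hKV : 0 < 1 / (κ * s₀ ^ n) * V := by positivity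
  have hw0 : 0 < w := hw ▸ lt_min one_pos (by linarith)
  have hw1 : w ≤ 1 := hw ▸ min_le_left _ _
  have hmw : m ≤ w := hw ▸ le_min hm1 (by linarith)
  have hN := luxNorm_indicator_le hΩ hU hp1 hl hw0 hw1 (h1P.trans hPP) hpP
    (hmE.trans_le (ENNReal.ofReal_le_ofReal hmw))
  have hLow := le_luxNorm_charFun hΩ hU hp1 hV hVE h1P hPp
  have hcase : P₂ - P₁ ≤ β / n ∨ w = 1 := by
    by_cases hss : s ≤ s₀
    · left
      have h2 : s ≤ 1 / 2 := hss.trans (hs₀ ▸ min_le_left _ _)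
      have h3 : Real.log s ≤ -(C₀ * n / β) := by
        rw [Real.log_le_iff_le_exp hs]
        exact hss.trans (hs₀ ▸ min_le_right _ _)
      have h4 : 0 < C₀ * n / β := by positivity
      calc P₂ - P₁ ≤ C₀ / (-Real.log s) := hosc h2
        _ ≤ C₀ / (C₀ * n / β) := by gcongr; linarith
        _ = β / n := by field_simp
    · right
      push Not at hss
      rw [hw, min_eq_left]
      have h5 : κ * s₀ ^ n ≤ V := le_trans (by gcongr) hVs
      have h6 : 1 ≤ 1 / (κ * s₀ ^ n) * V := by
        rw [one_div_mul_eq_div]; exact (one_le_div (by positivity)).2 h5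
      linarith
  have hpt : ∀ᵐ x ∂(volume.restrict Ω), x ∈ T.U t →
      ENNReal.ofReal (((volume (T.U t)).toReal ^ (α / n)
          * (luxNorm Ω p ((T.U t).indicator f) / luxNorm Ω p (charFun (T.U t)))
          / (L * ((17 / 16) ^ n * W * W / c * l))) ^ (q x)) ≤
        ENNReal.ofReal (L⁻¹ * (V⁻¹ * w)) := by
    filter_upwards [ae_restrict_mem hΩ, hPp, hpP, hpq] with x hxΩ hx1 hx2 hxpq hxU
    have hpx := hp1 x hxΩ
    have hqx := hq1 x hxΩ
    have hPx := hx1 hxU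
    have hxP := hx2 hxU
    refine ENNReal.ofReal_le_ofReal ?_
    refine term_rpow_le hν hαn hβ0 hβα hV hVW hW1 hD ENNReal.toReal_nonneg hUV hc0 hl hw0 hw1
      (h1P.trans hPP) (by linarith) hxpq (luxNorm_nonneg _ _ _) hN
      ((rpow_one_div_mul_le_min hV hVW hW1 h1P hPx (by linarith) hc0 hc1 hcV).trans hLow)
      rfl hL hqx (hcase.imp_left fun h => ?_)
    have hgap : q x - p x = β / n * (p x * q x) := by
      rw [← hxpq]; field_simp
    have hβn : 0 < β / n := by positivity
    have : 1 ≤ p x * q x := by nlinarith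
    nlinarith
  calc _ ≤ ∫⁻ _x in T.U t, ENNReal.ofReal (L⁻¹ * (V⁻¹ * w)) ∂(volume.restrict Ω) :=
        setLIntegral_mono_ae' hU hpt
    _ = ENNReal.ofReal L⁻¹ * ENNReal.ofReal w := by
        rw [setLIntegral_const, hVE, ← ENNReal.ofReal_mul (by positivity),
          ← ENNReal.ofReal_mul (by positivity)]
        congr 1
        field_simp
    _ ≤ _ := by
        rw [hmE, hVE, ← ENNReal.ofReal_mul (p := 1 / (κ * s₀ ^ n)) (by positivity),
          ← ENNReal.ofReal_add hm0 hKV.le]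
        gcongr
        exact hw ▸ min_le_right _ _

/-- Lemma 4.8, boundedness of `T^α_{p(·)} : L^{p(·)}(Ω) → L^{q(·)}(Ω)`. -/
theorem Tpa_bounded
    (n : ℕ) (Ω : Set (Eucl n)) (hΩo : IsOpen Ω) (hΩc : IsConnected Ω)
    (hΩb : Bornology.IsBounded Ω) (T : WhitneyTreeCovering n Ω)
    (α : ℝ) (hα0 : 0 < α) (hαn : α < n)
    (p q : Eucl n → ℝ) (hpm : Measurable p) (hqm : Measurable q)
    (hp1 : ∀ x ∈ Ω, 1 ≤ p x) (hq1 : ∀ x ∈ Ω, 1 ≤ q x)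
    (hpb : ∃ M : ℝ, ∀ᵐ x ∂(volume.restrict Ω), p x ≤ M)
    (hqb : ∃ M : ℝ, ∀ᵐ x ∂(volume.restrict Ω), q x ≤ M)
    (hpminus : 1 < essInfOn p Ω)
    (β : ℝ) (hβ0 : 0 < β) (hβα : β < α)
    (hpq : ∀ᵐ x ∂(volume.restrict Ω), 1 / p x - 1 / q x = β / n)
    (τ : ℝ) (hτ : 1 ≤ τ) (C₀ : ℝ) (hC₀ : 0 < C₀) (hLH : BoundaryLH Ω p τ C₀) :
    ∃ C : ℝ, ∀ f : Eucl n → ℝ, Measurable f → MemVarLp Ω p f →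
      luxNorm Ω q (Tpa T p α f) ≤ C * luxNorm Ω p f := by
  have hΩ := hΩo.measurableSet
  have := T.countable
  have hU : ∀ t, MeasurableSet (T.U t) := fun t => (isOpen_cubeU _ _).measurableSet
  obtain ⟨A, K, hA, hK, hterm⟩ := T.exists_term_modular_le hΩo hΩb hαn hp1 hq1 hpb hβ0 hβα hpq
    hτ hC₀ hLH
  have hC₁ := T.one_le_C₁
  have hΩfin : volume Ω ≠ ⊤ := hΩb.measure_lt_top.ne
  obtain ⟨L, hL⟩ : ∃ L, L = T.C₁ * (1 + K * (volume Ω).toReal) := ⟨_, rfl⟩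
  have hL1 : 1 ≤ L := by
    have : 0 ≤ K * (volume Ω).toReal := by positivity
    rw [hL]; nlinarith
  have hCpos : 0 < T.C₁ * (L * A) := by positivity
  refine ⟨T.C₁ * (L * A), fun f hf hmem => ?_⟩
  rw [← div_le_iff₀' hCpos]
  refine le_csInf hmem ?_
  rintro l ⟨hl, hmod⟩
  rw [div_le_iff₀' hCpos]
  refine luxNorm_le_of_modular_le (by positivity) ?_
  let a : T.ι → ℝ := fun t => (volume (T.U t)).toReal ^ (α / n)
    * (luxNorm Ω p ((T.U t).indicator f) / luxNorm Ω p (charFun (T.U t)))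
  have ha0 : ∀ t, 0 ≤ a t := fun t =>
    mul_nonneg (by positivity) (div_nonneg (luxNorm_nonneg _ _ _) (luxNorm_nonneg _ _ _))
  have hF : Measurable fun x => ENNReal.ofReal ((|f x| / l) ^ (p x)) := by fun_prop
  have hG : ∀ t, Measurable fun x => ENNReal.ofReal ((a t / (L * (A * l))) ^ (q x)) :=
    fun t => by fun_prop
  calc ∫⁻ x in Ω, ENNReal.ofReal ((|Tpa T p α f x| / (T.C₁ * (L * A) * l)) ^ (q x))
      ≤ ∫⁻ x in Ω, ∑' t, (T.U t).indicator
          (fun x => ENNReal.ofReal ((a t / (L * (A * l))) ^ (q x))) x := by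
        refine lintegral_mono_ae ?_
        filter_upwards [T.ae_finite_overlap hΩ, ae_restrict_mem hΩ]
          with x ⟨S, hSne, hcard, hS⟩ hxΩ
        have hT : Tpa T p α f x = ∑ t ∈ S, a t := by
          rw [Tpa, tsum_eq_sum (s := S)
            fun t ht => indicator_of_notMem (fun h => ht ((hS t).2 h)) _]
          exact Finset.sum_congr rfl fun t ht => indicator_of_mem ((hS t).1 ht) _
        rw [hT, abs_of_nonneg (Finset.sum_nonneg fun t _ => ha0 t),
          tsum_eq_sum (s := S) fun t ht => indicator_of_notMem (fun h => ht ((hS t).2 h)) _,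
          Finset.sum_congr rfl fun t ht => indicator_of_mem ((hS t).1 ht) _,
          ← ENNReal.ofReal_sum_of_nonneg fun t _ =>
            Real.rpow_nonneg (div_nonneg (ha0 t) (by positivity)) _]
        refine ENNReal.ofReal_le_ofReal ?_
        have hassoc : T.C₁ * (L * A) * l = T.C₁ * (L * (A * l)) := by ring
        rw [hassoc]
        exact sum_div_rpow_le_sum_rpow hSne (fun t _ => ha0 t) (by positivity) hcard
          (by linarith [hq1 x hxΩ])
    _ = ∑' t, ∫⁻ x in T.U t, ENNReal.ofReal ((a t / (L * (A * l))) ^ (q x))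
          ∂(volume.restrict Ω) := by
        rw [lintegral_tsum fun t => ((hG t).indicator (hU t)).aemeasurable]
        simp_rw [lintegral_indicator (hU _)]
    _ ≤ ∑' t, ENNReal.ofReal L⁻¹ *
          (∫⁻ x in T.U t, ENNReal.ofReal ((|f x| / l) ^ (p x)) ∂(volume.restrict Ω) +
            ENNReal.ofReal K * volume.restrict Ω (T.U t)) :=
        ENNReal.tsum_le_tsum fun t => hterm t f l L hl hL1 hmod
    _ = ENNReal.ofReal L⁻¹ *
          (∑' t, ∫⁻ x in T.U t, ENNReal.ofReal ((|f x| / l) ^ (p x)) ∂(volume.restrict Ω) +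
            ENNReal.ofReal K * ∑' t, ∫⁻ _x in T.U t, 1 ∂(volume.restrict Ω)) := by
        simp_rw [setLIntegral_one]
        rw [ENNReal.tsum_mul_left, ENNReal.tsum_add, ENNReal.tsum_mul_left]
    _ ≤ ENNReal.ofReal L⁻¹ * (ENNReal.ofReal T.C₁ * 1 +
          ENNReal.ofReal K * (ENNReal.ofReal T.C₁ * volume Ω)) := by
        gcongr
        · exact (T.tsum_setLIntegral_le hΩ hF).trans (by gcongr)
        · simpa using T.tsum_setLIntegral_le hΩ (measurable_const (a := (1 : ENNReal)))
    _ = ENNReal.ofReal (L⁻¹ * L) := by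
        rw [← ENNReal.ofReal_toReal hΩfin, mul_one, ← ENNReal.ofReal_mul (by positivity),
          ← ENNReal.ofReal_mul hK.le, ← ENNReal.ofReal_add (by positivity) (by positivity),
          ← ENNReal.ofReal_mul (by positivity)]
        congr 2
        rw [hL]; ring
    _ = 1 := by rw [inv_mul_cancel₀ (by positivity), ENNReal.ofReal_one]
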